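/- arXiv:1407.3978 — 2 statements merged into one kernel-verified Lean document; each statement's English description precedes it below -/
import Mathlib

section
/- Let T be a Leibniz triple system over a field K of characteristic 0 with universal Leibniz envelope U(T) and involutive automorphism θ determining T (θ(a + w) = −a + w for a ∈ T, w ∈ T ⊗ T). If f is an automorphism of T, then there is a unique automorphism f̃ of the Leibniz algebra U(T) such that f̃ restricted to T equals f and f̃ ∘ θ = θ ∘ f̃. -/
open TensorProduct

noncomputable section

variable {K : Type*} [Field K] [CharZero K]
variable {T : Type*} [AddCommGroup T] [Module K T]

/-- First defining identity of a Leibniz triple system: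
`{a{bcd}e} = {{abc}de} − {{acb}de} − {{adb}ce} + {{adc}be}`. -/
def LTS1 (t : T →ₗ[K] T →ₗ[K] T →ₗ[K] T) : Prop :=
  ∀ a b c d e : T,
    t a (t b c d) e =
      t (t a b c) d e - t (t a c b) d e - t (t a d b) c e + t (t a d c) b e

/-- Second defining identity of a Leibniz triple system:
`{ab{cde}} = {{abc}de} − {{abd}ce} − {{abe}cd} + {{abe}dc}`. -/
def LTS2 (t : T →ₗ[K] T →ₗ[K] T →ₗ[K] T) : Prop :=
  ∀ a b c d e : T,
    t a b (t c d e) =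
      t (t a b c) d e - t (t a b d) c e - t (t a b e) c d + t (t a b e) d c

/-- The axioms of a Lie triple system. -/
def IsLieTS (t : T →ₗ[K] T →ₗ[K] T →ₗ[K] T) : Prop :=
  (∀ a c : T, t a a c = 0) ∧
  (∀ a b c : T, t a b c + t b c a + t c a b = 0) ∧
  (∀ a b c d e : T,
    t a b (t c d e) = t (t a b c) d e + t c (t a b d) e + t c d (t a b e))

/-- The bracket of the universal Leibniz envelope `U(T) = T ⊕ (T ⊗ T)`,
determined by `[a,b] = a⊗b`, `[a⊗b,c] = {abc}`, `[a,b⊗c] = {abc} − {acb}`,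
`[a⊗b,c⊗d] = {abc}⊗d − {abd}⊗c`. -/
def bkt (t : T →ₗ[K] T →ₗ[K] T →ₗ[K] T) (x y : T × (T ⊗[K] T)) :
    T × (T ⊗[K] T) :=
  (TensorProduct.lift t x.2 y.1
      + TensorProduct.lift (t x.1) y.2 - TensorProduct.lift ((t x.1).flip) y.2,
   x.1 ⊗ₜ[K] y.1
      + LinearMap.rTensor T (TensorProduct.lift t x.2) y.2
      - LinearMap.rTensor T (TensorProduct.lift t x.2) (TensorProduct.comm K T T y.2))

/-- The induced bracket on the subalgebra `T ⊗ T` of `U(T)`. -/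
def bktT (t : T →ₗ[K] T →ₗ[K] T →ₗ[K] T) (w w' : T ⊗[K] T) : T ⊗[K] T :=
  LinearMap.rTensor T (TensorProduct.lift t w) w'
    - LinearMap.rTensor T (TensorProduct.lift t w) (TensorProduct.comm K T T w')

/-- `{ABC}`: the span of all products `{abc}` with `a ∈ A`, `b ∈ B`, `c ∈ C`. -/
def tspan (t : T →ₗ[K] T →ₗ[K] T →ₗ[K] T) (A B C : Submodule K T) : Submodule K T :=
  Submodule.span K {x | ∃ a ∈ A, ∃ b ∈ B, ∃ c ∈ C, x = t a b c}

/-- `I` is an ideal of the Leibniz triple system `(T, t)`. -/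
def IsIdealT (t : T →ₗ[K] T →ₗ[K] T →ₗ[K] T) (I : Submodule K T) : Prop :=
  ∀ x ∈ I, ∀ a b : T, t x a b ∈ I ∧ t a x b ∈ I ∧ t a b x ∈ I

/-- `i(I) = I ⊗ T + T ⊗ I` as a subspace of `T ⊗ T`. -/
def iI (I : Submodule K T) : Submodule K (T ⊗[K] T) :=
  Submodule.span K
    {z | (∃ x ∈ I, ∃ a : T, z = x ⊗ₜ[K] a) ∨ (∃ x ∈ I, ∃ a : T, z = a ⊗ₜ[K] x)}

/-- `j(I) = {w ∈ T⊗T | [w, T] + [T, w] ⊆ I}`. -/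
def jI (t : T →ₗ[K] T →ₗ[K] T →ₗ[K] T) (I : Submodule K T) : Submodule K (T ⊗[K] T) :=
  ⨅ a : T,
    Submodule.comap ((TensorProduct.lift t).flip a) I ⊓
      Submodule.comap (TensorProduct.lift (t a) - TensorProduct.lift ((t a).flip)) I

/-- `𝕀(I) = I + i(I)` as a subspace of `U(T)`. -/
def IU (I : Submodule K T) : Submodule K (T × (T ⊗[K] T)) := I.prod (iI I)

/-- `𝕁(I) = I + j(I)` as a subspace of `U(T)`. -/
def JU (t : T →ₗ[K] T →ₗ[K] T →ₗ[K] T) (I : Submodule K T) :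
    Submodule K (T × (T ⊗[K] T)) := I.prod (jI t I)

/-- `V` is an ideal of the Leibniz algebra `T ⊗ T`. -/
def IsIdealTT (t : T →ₗ[K] T →ₗ[K] T →ₗ[K] T) (V : Submodule K (T ⊗[K] T)) : Prop :=
  ∀ v ∈ V, ∀ w : T ⊗[K] T, bktT t v w ∈ V ∧ bktT t w v ∈ V

/-- `V` is an ideal of the Leibniz algebra `U(T)`. -/
def IsIdealU (t : T →ₗ[K] T →ₗ[K] T →ₗ[K] T) (V : Submodule K (T × (T ⊗[K] T))) : Prop :=
  ∀ v ∈ V, ∀ x : T × (T ⊗[K] T), bkt t v x ∈ V ∧ bkt t x v ∈ V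

/-- The derived series of `I` relative to an ambient subsystem `S`:
`I⁰ = I`, `Iⁿ⁺¹ = {S Iⁿ Iⁿ} + {Iⁿ S Iⁿ} + {Iⁿ Iⁿ S}`. -/
def derRel (t : T →ₗ[K] T →ₗ[K] T →ₗ[K] T) (S I : Submodule K T) : ℕ → Submodule K T
  | 0 => I
  | n + 1 =>
      tspan t S (derRel t S I n) (derRel t S I n) ⊔
        tspan t (derRel t S I n) S (derRel t S I n) ⊔
          tspan t (derRel t S I n) (derRel t S I n) S

/-- The derived series `I^[n]` of an ideal `I` of `T`:
`I^[0] = I`, `I^[n+1] = {T I^[n] I^[n]} + {I^[n] T I^[n]} + {I^[n] I^[n] T}`. -/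
def derT (t : T →ₗ[K] T →ₗ[K] T →ₗ[K] T) (I : Submodule K T) : ℕ → Submodule K T :=
  derRel t ⊤ I

/-- `I` is a solvable ideal of the Leibniz triple system `T`. -/
def IsSolvT (t : T →ₗ[K] T →ₗ[K] T →ₗ[K] T) (I : Submodule K T) : Prop :=
  ∃ k, derT t I k = ⊥

/-- The span of all brackets `[x, y]`, `x ∈ A`, `y ∈ B`, in `U(T)`. -/
def bspan (t : T →ₗ[K] T →ₗ[K] T →ₗ[K] T) (A B : Submodule K (T × (T ⊗[K] T))) :
    Submodule K (T × (T ⊗[K] T)) :=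
  Submodule.span K {z | ∃ x ∈ A, ∃ y ∈ B, z = bkt t x y}

/-- The derived series of a subspace `V` of the Leibniz algebra `U(T)`. -/
def derU (t : T →ₗ[K] T →ₗ[K] T →ₗ[K] T) (V : Submodule K (T × (T ⊗[K] T))) :
    ℕ → Submodule K (T × (T ⊗[K] T))
  | 0 => V
  | n + 1 => bspan t (derU t V n) (derU t V n)

/-- `V` is a solvable subspace of the Leibniz algebra `U(T)`. -/
def IsSolvU (t : T →ₗ[K] T →ₗ[K] T →ₗ[K] T) (V : Submodule K (T × (T ⊗[K] T))) : Prop :=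
  ∃ k, derU t V k = ⊥

/-- The solvable radical `R(T)`: the sum of all solvable ideals of `T`. -/
def radT (t : T →ₗ[K] T →ₗ[K] T →ₗ[K] T) : Submodule K T :=
  sSup {S : Submodule K T | IsIdealT t S ∧ IsSolvT t S}

/-- The solvable radical `Rad(U(T))`: the sum of all solvable ideals of `U(T)`. -/
def radU (t : T →ₗ[K] T →ₗ[K] T →ₗ[K] T) : Submodule K (T × (T ⊗[K] T)) :=
  sSup {V : Submodule K (T × (T ⊗[K] T)) | IsIdealU t V ∧ IsSolvU t V}

/-- `Ker(T)`: the span of all `{abc} − {acb} + {bca}`. -/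
def kerT (t : T →ₗ[K] T →ₗ[K] T →ₗ[K] T) : Submodule K T :=
  Submodule.span K {x | ∃ a b c : T, x = t a b c - t a c b + t b c a}

/-- `Ker(U(T))`: the span of all `[x, x]`, `x ∈ U(T)`. -/
def kerU (t : T →ₗ[K] T →ₗ[K] T →ₗ[K] T) : Submodule K (T × (T ⊗[K] T)) :=
  Submodule.span K {z | ∃ x : T × (T ⊗[K] T), z = bkt t x x}

/-- The central lower sequence of an ideal `I` of `T`: `I⁰ = I`,
`Iᵐ⁺¹ = {Iᵐ I T} + {Iᵐ T I} + {I Iᵐ T} + {I T Iᵐ} + {T I Iᵐ} + {T Iᵐ I}`. -/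
def clsT (t : T →ₗ[K] T →ₗ[K] T →ₗ[K] T) (I : Submodule K T) : ℕ → Submodule K T
  | 0 => I
  | m + 1 =>
      tspan t (clsT t I m) I ⊤ ⊔ tspan t (clsT t I m) ⊤ I ⊔
        tspan t I (clsT t I m) ⊤ ⊔ tspan t I ⊤ (clsT t I m) ⊔
          tspan t ⊤ I (clsT t I m) ⊔ tspan t ⊤ (clsT t I m) I

/-- `I` is a nilpotent ideal of the Leibniz triple system `T`. -/
def IsNilT (t : T →ₗ[K] T →ₗ[K] T →ₗ[K] T) (I : Submodule K T) : Prop :=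
  ∃ n, clsT t I n = ⊥

/-- The lower central series of a subspace `V` of the Leibniz algebra `U(T)`:
`V⁰ = V`, `Vᵐ⁺¹ = [Vᵐ, V]`. -/
def clsU (t : T →ₗ[K] T →ₗ[K] T →ₗ[K] T) (V : Submodule K (T × (T ⊗[K] T))) :
    ℕ → Submodule K (T × (T ⊗[K] T))
  | 0 => V
  | m + 1 => bspan t (clsU t V m) V

/-- `V` is a nilpotent subspace of the Leibniz algebra `U(T)`. -/
def IsNilU (t : T →ₗ[K] T →ₗ[K] T →ₗ[K] T) (V : Submodule K (T × (T ⊗[K] T))) : Prop :=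
  ∃ n, clsU t V n = ⊥

/-- `Tⁿ`: the lower central series of `T`, `T⁰ = T`,
`Tⁿ⁺¹ = {Tⁿ T T} + {T Tⁿ T} + {T T Tⁿ}`. -/
def lcsT (t : T →ₗ[K] T →ₗ[K] T →ₗ[K] T) : ℕ → Submodule K T
  | 0 => ⊤
  | n + 1 => tspan t (lcsT t n) ⊤ ⊤ ⊔ tspan t ⊤ (lcsT t n) ⊤ ⊔ tspan t ⊤ ⊤ (lcsT t n)

/-- `T⁽ⁿ⁾`: `T⁽⁰⁾ = T`, `T⁽ⁿ⁺¹⁾ = {T⁽ⁿ⁾ T T}`. -/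
def powT (t : T →ₗ[K] T →ₗ[K] T →ₗ[K] T) : ℕ → Submodule K T
  | 0 => ⊤
  | n + 1 => tspan t (powT t n) ⊤ ⊤


section Envelope

variable {K T : Type*} [Field K] [AddCommGroup T] [Module K T]
  {t : T →ₗ[K] T →ₗ[K] T →ₗ[K] T}

theorem map_lift_congr (f : T ≃ₗ[K] T)
    (hf : ∀ a b c : T, f (t a b c) = t (f a) (f b) (f c)) (w : T ⊗[K] T) (c : T) :
    f (TensorProduct.lift t w c) =
      TensorProduct.lift t (TensorProduct.congr f f w) (f c) := by
  induction w with
  | zero => simp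
  | tmul a b => simp [hf]
  | add u v hu hv => simp [hu, hv]

theorem map_lift_left_congr (f : T ≃ₗ[K] T)
    (hf : ∀ a b c : T, f (t a b c) = t (f a) (f b) (f c)) (a : T) (w : T ⊗[K] T) :
    f (TensorProduct.lift (t a) w) =
      TensorProduct.lift (t (f a)) (TensorProduct.congr f f w) := by
  induction w with
  | zero => simp
  | tmul b c => simp [hf]
  | add u v hu hv => simp [hu, hv]

theorem map_lift_left_flip_congr (f : T ≃ₗ[K] T)
    (hf : ∀ a b c : T, f (t a b c) = t (f a) (f b) (f c)) (a : T) (w : T ⊗[K] T) :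
    f (TensorProduct.lift (t a).flip w) =
      TensorProduct.lift (t (f a)).flip (TensorProduct.congr f f w) := by
  induction w with
  | zero => simp
  | tmul b c => simp [hf]
  | add u v hu hv => simp [hu, hv]

theorem congr_rTensor_lift (f : T ≃ₗ[K] T)
    (hf : ∀ a b c : T, f (t a b c) = t (f a) (f b) (f c)) (w w' : T ⊗[K] T) :
    TensorProduct.congr f f (LinearMap.rTensor T (TensorProduct.lift t w) w') =
      LinearMap.rTensor T (TensorProduct.lift t (TensorProduct.congr f f w))
        (TensorProduct.congr f f w') := by
  induction w' with
  | zero => simp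
  | tmul b c => simp [map_lift_congr f hf]
  | add u v hu hv => simp only [map_add, hu, hv]

theorem congr_comm (f : T ≃ₗ[K] T) (w : T ⊗[K] T) :
    TensorProduct.congr f f (TensorProduct.comm K T T w) =
      TensorProduct.comm K T T (TensorProduct.congr f f w) := by
  induction w with
  | zero => simp
  | tmul b c => simp
  | add u v hu hv => simp only [map_add, hu, hv]

theorem prodCongr_bkt (f : T ≃ₗ[K] T)
    (hf : ∀ a b c : T, f (t a b c) = t (f a) (f b) (f c)) (x y : T × (T ⊗[K] T)) :
    f.prodCongr (TensorProduct.congr f f) (bkt t x y) =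
      bkt t (f.prodCongr (TensorProduct.congr f f) x)
        (f.prodCongr (TensorProduct.congr f f) y) := by
  ext1
  · simp only [bkt, LinearEquiv.prodCongr_apply, map_add, map_sub, map_lift_congr f hf,
      map_lift_left_congr f hf, map_lift_left_flip_congr f hf]
  · simp only [bkt, LinearEquiv.prodCongr_apply, map_add, map_sub, congr_rTensor_lift f hf,
      congr_comm, TensorProduct.congr_tmul]

theorem bkt_inl_inl (a b : T) : bkt t (a, 0) (b, 0) = (0, a ⊗ₜ[K] b) := by
  simp [bkt]

/-- `T` generates `U(T)`, so a bracket-preserving linear map is determined by its values on `T`. -/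
theorem bkt_hom_ext {F G : (T × (T ⊗[K] T)) →ₗ[K] (T × (T ⊗[K] T))}
    (hF : ∀ x y, F (bkt t x y) = bkt t (F x) (F y))
    (hG : ∀ x y, G (bkt t x y) = bkt t (G x) (G y))
    (h : ∀ a : T, F (a, 0) = G (a, 0)) : F = G := by
  refine LinearMap.prod_ext (LinearMap.ext h) (TensorProduct.ext' fun a b => ?_)
  change F (0, a ⊗ₜ[K] b) = G (0, a ⊗ₜ[K] b)
  rw [← bkt_inl_inl (t := t), hF, hG, h, h]

end Envelope

/-- Every automorphism `f` of `T` extends uniquely to an automorphism `F` of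
`U(T)` with `F|_T = f` and `F ∘ θ = θ ∘ F`, where `θ(a + w) = −a + w`. -/
theorem automorphism_extends_to_envelope
    (t : T →ₗ[K] T →ₗ[K] T →ₗ[K] T) (h1 : LTS1 t) (h2 : LTS2 t)
    (f : T ≃ₗ[K] T) (hf : ∀ a b c : T, f (t a b c) = t (f a) (f b) (f c)) :
    ∃! F : (T × (T ⊗[K] T)) ≃ₗ[K] (T × (T ⊗[K] T)),
      (∀ x y, F (bkt t x y) = bkt t (F x) (F y)) ∧
      (∀ a : T, F (a, 0) = (f a, 0)) ∧
      (∀ x : T × (T ⊗[K] T), F (-x.1, x.2) = (-(F x).1, (F x).2)) := by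
  refine ⟨f.prodCongr (TensorProduct.congr f f), ⟨prodCongr_bkt f hf, ?_, ?_⟩, ?_⟩
  · intro a
    simp
  · intro x
    simp
  · rintro G ⟨hG, hGf, -⟩
    refine LinearEquiv.toLinearMap_injective (bkt_hom_ext (t := t) hG (prodCongr_bkt f hf) ?_)
    intro a
    simp [hGf]


end
end

section
/- Let T be a Leibniz triple system over a field K of characteristic 0 with universal Leibniz envelope U(T), and let I be an ideal of T. Then the following are equivalent: (1) I is a solvable ideal of T; (2) 𝕀(I) is a solvable ideal of the Leibniz algebra U(T); (3) 𝕁(I) is a solvable ideal of the Leibniz algebra U(T). In particular, T is solvable if and only if U(T) is a solvable Leibniz algebra. -/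
open TensorProduct

noncomputable section

variable {K : Type*} [Field K] [CharZero K]
variable {T : Type*} [AddCommGroup T] [Module K T]

set_option linter.unusedSectionVars false

/-- The span of the pure tensors `a ⊗ b` with `R a b`. -/
def tensorSpan (K : Type*) [Field K] {T : Type*} [AddCommGroup T] [Module K T]
    (R : T → T → Prop) : Submodule K (T ⊗[K] T) :=
  Submodule.span K {z | ∃ a b, R a b ∧ z = a ⊗ₜ[K] b}

theorem tmul_mem_tensorSpan {R : T → T → Prop} {a b : T} (h : R a b) :
    a ⊗ₜ[K] b ∈ tensorSpan K R :=
  Submodule.subset_span ⟨a, b, h, rfl⟩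

theorem iI_eq_tensorSpan (J : Submodule K T) :
    iI J = tensorSpan K fun a b => a ∈ J ∨ b ∈ J := by
  unfold iI tensorSpan
  congr 1
  ext z
  constructor
  · rintro (⟨x, hx, a, rfl⟩ | ⟨x, hx, a, rfl⟩)
    · exact ⟨x, a, Or.inl hx, rfl⟩
    · exact ⟨a, x, Or.inr hx, rfl⟩
  · rintro ⟨a, b, h | h, rfl⟩
    · exact Or.inl ⟨a, h, b, rfl⟩
    · exact Or.inr ⟨b, h, a, rfl⟩

theorem tensorSpan_true : tensorSpan K (fun _ _ : T => True) = ⊤ := by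
  rw [← TensorProduct.span_tmul_eq_top]
  unfold tensorSpan
  congr 1
  ext z
  simp [eq_comm]

theorem iI_bot : iI (⊥ : Submodule K T) = ⊥ := by
  rw [iI, Submodule.span_eq_bot]
  rintro z (⟨x, hx, a, rfl⟩ | ⟨x, hx, a, rfl⟩) <;> simp [(Submodule.mem_bot K).1 hx]

theorem iI_top : iI (⊤ : Submodule K T) = ⊤ := by
  rw [iI_eq_tensorSpan, ← tensorSpan_true]
  simp

theorem lift_add_apply (f g : T →ₗ[K] T →ₗ[K] T) (w : T ⊗[K] T) :
    TensorProduct.lift (f + g) w = TensorProduct.lift f w + TensorProduct.lift g w :=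
  LinearMap.congr_fun
    (map_add (TensorProduct.lift.equiv (RingHom.id K) T T T) f g) w

theorem lift_smul_apply (c : K) (f : T →ₗ[K] T →ₗ[K] T) (w : T ⊗[K] T) :
    TensorProduct.lift (c • f) w = c • TensorProduct.lift f w :=
  LinearMap.congr_fun
    (map_smul (TensorProduct.lift.equiv (RingHom.id K) T T T) c f) w

theorem flip_add (f g : T →ₗ[K] T →ₗ[K] T) : (f + g).flip = f.flip + g.flip := rfl

theorem flip_smul (c : K) (f : T →ₗ[K] T →ₗ[K] T) : (c • f).flip = c • f.flip := rfl

/-- The bracket of `U(T)` as a bilinear map. -/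
def bktHom (t : T →ₗ[K] T →ₗ[K] T →ₗ[K] T) :
    T × (T ⊗[K] T) →ₗ[K] T × (T ⊗[K] T) →ₗ[K] T × (T ⊗[K] T) :=
  LinearMap.mk₂ K (bkt t)
    (fun x x' y => by
      ext1
      · simp [bkt, flip_add, lift_add_apply]
        abel
      · simp [bkt, TensorProduct.add_tmul, LinearMap.rTensor_add]
        abel)
    (fun c x y => by
      ext1
      · simp [bkt, smul_add, smul_sub, flip_smul, lift_smul_apply]
      · simp [bkt, smul_add, smul_sub, TensorProduct.smul_tmul', LinearMap.rTensor_smul])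
    (fun x y y' => by
      ext1
      · simp [bkt]
        abel
      · simp [bkt, TensorProduct.tmul_add]
        abel)
    (fun c x y => by
      ext1 <;> simp [bkt, smul_add, smul_sub])

@[simp]
theorem bktHom_apply (t : T →ₗ[K] T →ₗ[K] T →ₗ[K] T) (x y : T × (T ⊗[K] T)) :
    bktHom t x y = bkt t x y := rfl

@[elab_as_elim]
theorem envelope_induction {p : T × (T ⊗[K] T) → Prop}
    (inl : ∀ a : T, p (a, 0)) (inr : ∀ a b : T, p (0, a ⊗ₜ[K] b))
    (hadd : ∀ x y, p x → p y → p (x + y)) (x : T × (T ⊗[K] T)) : p x := by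
  obtain ⟨a, w⟩ := x
  have key : p (0, w) := by
    induction w with
    | zero => exact inl 0
    | tmul a b => exact inr a b
    | add u v hu hv => simpa using hadd _ _ hu hv
  simpa using hadd _ _ (inl a) key

theorem bkt_add_left (t : T →ₗ[K] T →ₗ[K] T →ₗ[K] T) (x x' y : T × (T ⊗[K] T)) :
    bkt t (x + x') y = bkt t x y + bkt t x' y :=
  LinearMap.map_add₂ (bktHom t) x x' y

theorem bkt_add_right (t : T →ₗ[K] T →ₗ[K] T →ₗ[K] T) (x y y' : T × (T ⊗[K] T)) :
    bkt t x (y + y') = bkt t x y + bkt t x y' :=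
  map_add (bktHom t x) y y'

theorem mem_jI {t : T →ₗ[K] T →ₗ[K] T →ₗ[K] T} {J : Submodule K T} {w : T ⊗[K] T} :
    w ∈ jI t J ↔ ∀ a, TensorProduct.lift t w a ∈ J ∧
      TensorProduct.lift (t a) w - TensorProduct.lift ((t a).flip) w ∈ J := by
  simp [jI, Submodule.mem_iInf]

theorem mem_JU_bot {t : T →ₗ[K] T →ₗ[K] T →ₗ[K] T} {x : T × (T ⊗[K] T)} :
    x ∈ JU t ⊥ ↔ x.1 = 0 ∧ ∀ a, TensorProduct.lift t x.2 a = 0 ∧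
      TensorProduct.lift (t a) x.2 - TensorProduct.lift ((t a).flip) x.2 = 0 := by
  simp only [JU, Submodule.mem_prod, mem_jI, Submodule.mem_bot]

/-- The failure of the right Leibniz identity in `U(T)`. -/
def leibnizDefect (t : T →ₗ[K] T →ₗ[K] T →ₗ[K] T) (x y z : T × (T ⊗[K] T)) :
    T × (T ⊗[K] T) :=
  bkt t (bkt t x y) z - bkt t (bkt t x z) y - bkt t x (bkt t y z)

set_option maxHeartbeats 1000000 in
/-- The right Leibniz identity holds in `U(T)` modulo the elements of `T ⊗ T` that act
trivially on `T` from both sides. -/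
theorem leibnizDefect_mem {t : T →ₗ[K] T →ₗ[K] T →ₗ[K] T} (h1 : LTS1 t) (h2 : LTS2 t)
    (x y z : T × (T ⊗[K] T)) : leibnizDefect t x y z ∈ JU t ⊥ := by
  have h1' : ∀ a b c d e, t a (t b c d) e = _ := h1
  have h2' : ∀ a b c d e, t a b (t c d e) = _ := h2
  induction x using envelope_induction with
  | hadd x x' hx hx' =>
    convert add_mem hx hx' using 1
    simp only [leibnizDefect, bkt_add_left]
    abel
  | _ =>
    induction y using envelope_induction with
    | hadd y y' hy hy' =>
      convert add_mem hy hy' using 1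
      simp only [leibnizDefect, bkt_add_left, bkt_add_right]
      abel
    | _ =>
      induction z using envelope_induction with
      | hadd z z' hz hz' =>
        convert add_mem hz hz' using 1
        simp only [leibnizDefect, bkt_add_left, bkt_add_right]
        abel
      | _ =>
        rw [mem_JU_bot]
        refine ⟨?_, fun e => ⟨?_, ?_⟩⟩ <;>
          simp [leibnizDefect, bkt, h1', h2', TensorProduct.sub_tmul, TensorProduct.add_tmul,
            TensorProduct.tmul_sub] <;>
          abel

theorem bkt_mem_JU_bot_left {t : T →ₗ[K] T →ₗ[K] T →ₗ[K] T} {s : T × (T ⊗[K] T)}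
    (hs : s ∈ JU t ⊥) (x : T × (T ⊗[K] T)) : bkt t s x ∈ JU t ⊥ := by
  obtain ⟨h, h'⟩ := mem_JU_bot.1 hs
  have h0 : TensorProduct.lift t s.2 = 0 := LinearMap.ext fun a => (h' a).1
  have hbkt : bkt t s x = 0 := by
    ext1
    · simp only [bkt, h, h0, map_zero, LinearMap.zero_apply, add_sub_assoc, zero_add]
      rw [show (0 : T →ₗ[K] T →ₗ[K] T).flip = 0 from rfl, sub_self]
      rfl
    · simp [bkt, h, h0]
  rw [hbkt]
  exact zero_mem _

theorem bkt_mem_JU_bot_right {t : T →ₗ[K] T →ₗ[K] T →ₗ[K] T} (h1 : LTS1 t) (h2 : LTS2 t)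
    {s : T × (T ⊗[K] T)} (hs : s ∈ JU t ⊥) (x : T × (T ⊗[K] T)) : bkt t x s ∈ JU t ⊥ := by
  have fst_right : ∀ {s}, s ∈ JU t ⊥ → ∀ x, (bkt t x s).1 = 0 := by
    intro s hs x
    obtain ⟨h, h'⟩ := mem_JU_bot.1 hs
    simp only [bkt, h, map_zero, zero_add]
    exact (h' x.1).2
  have fst_left : ∀ {s}, s ∈ JU t ⊥ → ∀ x, (bkt t s x).1 = 0 := fun hs x =>
    (mem_JU_bot.1 (bkt_mem_JU_bot_left hs x)).1
  rw [mem_JU_bot]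
  refine ⟨fst_right hs x, fun e => ⟨?_, ?_⟩⟩
  · have h := (mem_JU_bot.1 (leibnizDefect_mem h1 h2 x s (e, 0))).1
    have h₁ := fst_right hs (bkt t x (e, 0))
    have h₂ := fst_right (bkt_mem_JU_bot_left hs (e, 0)) x
    have h₃ := fst_right hs x
    simp only [leibnizDefect, Prod.fst_sub, h₁, h₂, sub_zero] at h
    simpa [bkt, h₃] using h
  · have h := (mem_JU_bot.1 (leibnizDefect_mem h1 h2 (e, 0) x s)).1
    have h₁ := fst_right hs (bkt t (e, 0) x)
    have h₂ : bkt t (e, 0) s = 0 := by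
      ext1
      · exact fst_right hs (e, 0)
      · simp [bkt, (mem_JU_bot.1 hs).1]
    have h₃ : ∀ y, (bkt t 0 y).1 = 0 := fun y => fst_left (zero_mem _) y
    simp only [leibnizDefect, Prod.fst_sub, h₁, h₂, h₃, sub_zero, zero_sub, neg_eq_zero] at h
    simpa [bkt, fst_right hs x] using h

/-- A criterion for brackets of graded subspaces of `U(T)` to lie in a graded subspace. -/
theorem bkt_mem_prod {t : T →ₗ[K] T →ₗ[K] T →ₗ[K] T} {J₁ J₂ N : Submodule K T}
    {M : Submodule K (T ⊗[K] T)} {R₁ R₂ : T → T → Prop}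
    (hll : ∀ x ∈ J₁, ∀ y ∈ J₂, x ⊗ₜ[K] y ∈ M)
    (hlr : ∀ x ∈ J₁, ∀ c d, R₂ c d → t x c d - t x d c ∈ N)
    (hrl : ∀ a b, R₁ a b → ∀ y ∈ J₂, t a b y ∈ N)
    (hrr : ∀ a b, R₁ a b → ∀ c d, R₂ c d →
      t a b c ⊗ₜ[K] d - t a b d ⊗ₜ[K] c ∈ M)
    {x y : T × (T ⊗[K] T)} (hx : x ∈ J₁.prod (tensorSpan K R₁))
    (hy : y ∈ J₂.prod (tensorSpan K R₂)) : bkt t x y ∈ N.prod M := by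
  have key : ∀ {J : Submodule K T} {R : T → T → Prop} (P : Submodule K (T × (T ⊗[K] T))),
      (∀ a ∈ J, (a, 0) ∈ P) → (∀ a b, R a b → (0, a ⊗ₜ[K] b) ∈ P) →
      J.prod (tensorSpan K R) ≤ P := by
    intro J R P hl hr
    rw [Submodule.prod_le_iff, tensorSpan, Submodule.map_span_le]
    refine ⟨?_, ?_⟩
    · rintro _ ⟨a, ha, rfl⟩
      exact hl a ha
    · rintro _ ⟨a, b, h, rfl⟩
      exact hr a b h
  refine key ((N.prod M).comap ((bktHom t).flip y)) (fun a ha => ?_) (fun a b hab => ?_) hx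
  · refine key ((N.prod M).comap (bktHom t (a, 0))) (fun c hc => ?_) (fun c d hcd => ?_) hy
    · simpa [bkt] using hll a ha c hc
    · simpa [bkt] using hlr a ha c d hcd
  · refine key ((N.prod M).comap (bktHom t (0, a ⊗ₜ[K] b))) (fun c hc => ?_)
      (fun c d hcd => ?_) hy
    · simpa [bkt] using hrl a b hab c hc
    · simpa [bkt] using hrr a b hab c d hcd

/-- One step of the derived series of a Leibniz triple system. -/
def derStep (t : T →ₗ[K] T →ₗ[K] T →ₗ[K] T) (J : Submodule K T) : Submodule K T :=
  tspan t ⊤ J J ⊔ tspan t J ⊤ J ⊔ tspan t J J ⊤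

section DerStep

variable {t : T →ₗ[K] T →ₗ[K] T →ₗ[K] T} {J : Submodule K T}

theorem derStep_mem_left (a : T) {b c : T} (hb : b ∈ J) (hc : c ∈ J) :
    t a b c ∈ derStep t J :=
  Submodule.mem_sup_left (Submodule.mem_sup_left
    (Submodule.subset_span ⟨a, trivial, b, hb, c, hc, rfl⟩))

theorem derStep_mem_mid {a : T} (b : T) {c : T} (ha : a ∈ J) (hc : c ∈ J) :
    t a b c ∈ derStep t J :=
  Submodule.mem_sup_left (Submodule.mem_sup_right
    (Submodule.subset_span ⟨a, ha, b, trivial, c, hc, rfl⟩))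

theorem derStep_mem_right {a b : T} (c : T) (ha : a ∈ J) (hb : b ∈ J) :
    t a b c ∈ derStep t J :=
  Submodule.mem_sup_right (Submodule.subset_span ⟨a, ha, b, hb, c, trivial, rfl⟩)

theorem derStep_le {N : Submodule K T}
    (hl : ∀ a, ∀ b ∈ J, ∀ c ∈ J, t a b c ∈ N) (hm : ∀ a ∈ J, ∀ b, ∀ c ∈ J, t a b c ∈ N)
    (hr : ∀ a ∈ J, ∀ b ∈ J, ∀ c, t a b c ∈ N) : derStep t J ≤ N := by
  refine sup_le (sup_le ?_ ?_) ?_ <;> refine Submodule.span_le.2 ?_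
  · rintro _ ⟨a, -, b, hb, c, hc, rfl⟩
    exact hl a b hb c hc
  · rintro _ ⟨a, ha, b, -, c, hc, rfl⟩
    exact hm a ha b c hc
  · rintro _ ⟨a, ha, b, hb, c, -, rfl⟩
    exact hr a ha b hb c

end DerStep

theorem bkt_mem_bspan {t : T →ₗ[K] T →ₗ[K] T →ₗ[K] T} {A B : Submodule K (T × (T ⊗[K] T))}
    {x y : T × (T ⊗[K] T)} (hx : x ∈ A) (hy : y ∈ B) : bkt t x y ∈ bspan t A B :=
  Submodule.subset_span ⟨x, hx, y, hy, rfl⟩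

theorem bspan_le {t : T →ₗ[K] T →ₗ[K] T →ₗ[K] T} {A B W : Submodule K (T × (T ⊗[K] T))}
    (h : ∀ x ∈ A, ∀ y ∈ B, bkt t x y ∈ W) : bspan t A B ≤ W := by
  refine Submodule.span_le.2 ?_
  rintro _ ⟨x, hx, y, hy, rfl⟩
  exact h x hx y hy

theorem bspan_mono {t : T →ₗ[K] T →ₗ[K] T →ₗ[K] T} {A A' B B' : Submodule K (T × (T ⊗[K] T))}
    (hA : A ≤ A') (hB : B ≤ B') : bspan t A B ≤ bspan t A' B' :=
  bspan_le fun _ hx _ hy => bkt_mem_bspan (hA hx) (hB hy)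

theorem derU_mono {t : T →ₗ[K] T →ₗ[K] T →ₗ[K] T} {V W : Submodule K (T × (T ⊗[K] T))}
    (h : V ≤ W) (n : ℕ) : derU t V n ≤ derU t W n := by
  induction n with
  | zero => exact h
  | succ n ih => exact bspan_mono ih ih

theorem derU_succ' (t : T →ₗ[K] T →ₗ[K] T →ₗ[K] T) (V : Submodule K (T × (T ⊗[K] T)))
    (n : ℕ) : derU t V (n + 1) = derU t (bspan t V V) n := by
  induction n with
  | zero => rfl
  | succ n ih =>
    change bspan t (derU t V (n + 1)) (derU t V (n + 1)) = _
    rw [ih]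
    rfl

theorem IsSolvU.mono {t : T →ₗ[K] T →ₗ[K] T →ₗ[K] T} {V W : Submodule K (T × (T ⊗[K] T))}
    (h : V ≤ W) (hW : IsSolvU t W) : IsSolvU t V := by
  obtain ⟨k, hk⟩ := hW
  exact ⟨k, le_bot_iff.1 (hk ▸ derU_mono h k)⟩

theorem IsSolvU.of_bspan {t : T →ₗ[K] T →ₗ[K] T →ₗ[K] T} {V : Submodule K (T × (T ⊗[K] T))}
    (h : IsSolvU t (bspan t V V)) : IsSolvU t V := by
  obtain ⟨k, hk⟩ := h
  exact ⟨k + 1, (derU_succ' t V k).trans hk⟩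

theorem sup_JU_bot_isIdealU {t : T →ₗ[K] T →ₗ[K] T →ₗ[K] T} (h1 : LTS1 t) (h2 : LTS2 t)
    {W : Submodule K (T × (T ⊗[K] T))}
    (hW : ∀ v ∈ W, ∀ x, bkt t v x ∈ W ⊔ JU t ⊥ ∧ bkt t x v ∈ W ⊔ JU t ⊥) :
    IsIdealU t (W ⊔ JU t ⊥) := by
  intro v hv x
  obtain ⟨w, hw, s, hs, rfl⟩ := Submodule.mem_sup.1 hv
  rw [bkt_add_left, bkt_add_right]
  exact ⟨add_mem (hW w hw x).1 (Submodule.mem_sup_right (bkt_mem_JU_bot_left hs x)),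
    add_mem (hW w hw x).2 (Submodule.mem_sup_right (bkt_mem_JU_bot_right h1 h2 hs x))⟩

theorem IsIdealU.bspan_self_sup {t : T →ₗ[K] T →ₗ[K] T →ₗ[K] T} (h1 : LTS1 t) (h2 : LTS2 t)
    {V : Submodule K (T × (T ⊗[K] T))} (hV : IsIdealU t V) :
    IsIdealU t (bspan t V V ⊔ JU t ⊥) := by
  have hmem : ∀ {x y}, x ∈ V → y ∈ V → bkt t x y ∈ bspan t V V ⊔ JU t ⊥ := fun hx hy =>
    Submodule.mem_sup_left (bkt_mem_bspan hx hy)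
  refine sup_JU_bot_isIdealU h1 h2 fun v hv z => ⟨?_, ?_⟩
  · refine bspan_le (W := (bspan t V V ⊔ JU t ⊥).comap ((bktHom t).flip z))
      (fun x hx y hy => ?_) hv
    have h := Submodule.mem_sup_right (S := bspan t V V) (leibnizDefect_mem h1 h2 x y z)
    have h' := add_mem (add_mem h (hmem (hV x hx z).1 hy)) (hmem hx (hV y hy z).1)
    rw [Submodule.mem_comap, LinearMap.flip_apply, bktHom_apply]
    convert h' using 1
    rw [leibnizDefect]
    abel
  · refine bspan_le (W := (bspan t V V ⊔ JU t ⊥).comap (bktHom t z)) (fun x hx y hy => ?_) hv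
    have h := Submodule.mem_sup_right (S := bspan t V V) (leibnizDefect_mem h1 h2 z x y)
    have h' := sub_mem (sub_mem (hmem (hV x hx z).2 hy) (hmem (hV y hy z).2 hx)) h
    simp only [leibnizDefect] at h'
    simpa using h'

theorem bkt_bkt_inl (t : T →ₗ[K] T →ₗ[K] T →ₗ[K] T) (a b c : T) :
    bkt t (bkt t (a, 0) (b, 0)) (c, 0) = (t a b c, 0) := by
  ext1 <;> simp [bkt]

theorem inl_derStep_le_bspan {t : T →ₗ[K] T →ₗ[K] T →ₗ[K] T} (h1 : LTS1 t) (h2 : LTS2 t)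
    {V : Submodule K (T × (T ⊗[K] T))} (hV : IsIdealU t V) {J : Submodule K T}
    (hJ : ∀ x ∈ J, (x, 0) ∈ V) : ∀ x ∈ derStep t J, (x, 0) ∈ bspan t V V ⊔ JU t ⊥ := by
  refine derStep_le (N := (bspan t V V ⊔ JU t ⊥).comap (LinearMap.inl K T (T ⊗[K] T)))
    (fun a b hb c hc => ?_) (fun a ha b c hc => ?_) (fun a ha b hb c => ?_) <;>
    rw [Submodule.mem_comap, LinearMap.inl_apply, ← bkt_bkt_inl]
  · exact Submodule.mem_sup_left (bkt_mem_bspan (hV _ (hJ b hb) _).2 (hJ c hc))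
  · exact Submodule.mem_sup_left (bkt_mem_bspan (hV _ (hJ a ha) _).1 (hJ c hc))
  · exact ((hV.bspan_self_sup h1 h2) _
      (Submodule.mem_sup_left (bkt_mem_bspan (hJ a ha) (hJ b hb))) _).1

theorem IU_top : IU (⊤ : Submodule K T) = ⊤ := by
  rw [IU, iI_top, Submodule.prod_top]

theorem IU_bot : IU (⊥ : Submodule K T) = ⊥ := by
  rw [IU, iI_bot, Submodule.prod_bot]

section Ideal

variable {t : T →ₗ[K] T →ₗ[K] T →ₗ[K] T} {J : Submodule K T}

theorem IsIdealT.isIdealU_IU (hJ : IsIdealT t J) : IsIdealU t (IU J) := by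
  intro v hv x
  have hx : x ∈ (⊤ : Submodule K T).prod (tensorSpan K fun _ _ : T => True) := by
    rw [tensorSpan_true]
    exact ⟨trivial, trivial⟩
  rw [IU, iI_eq_tensorSpan] at hv ⊢
  constructor
  · refine bkt_mem_prod (fun a ha b _ => ?_) (fun a ha c d _ => ?_) (fun a b h y _ => ?_)
      (fun a b h c d _ => ?_) hv hx
    · exact tmul_mem_tensorSpan (Or.inl ha)
    · exact sub_mem (hJ a ha c d).1 (hJ a ha d c).1
    · exact h.elim (fun h => (hJ a h b y).1) (fun h => (hJ b h a y).2.1)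
    · have key : ∀ y, t a b y ∈ J := fun y =>
        h.elim (fun h => (hJ a h b y).1) (fun h => (hJ b h a y).2.1)
      exact sub_mem (tmul_mem_tensorSpan (Or.inl (key c))) (tmul_mem_tensorSpan (Or.inl (key d)))
  · refine bkt_mem_prod (fun a _ b hb => ?_) (fun a _ c d h => ?_) (fun a b _ y hy => ?_)
      (fun a b _ c d h => ?_) hx hv
    · exact tmul_mem_tensorSpan (Or.inr hb)
    · rcases h with h | h
      · exact sub_mem (hJ c h a d).2.1 (hJ c h a d).2.2
      · exact sub_mem (hJ d h a c).2.2 (hJ d h a c).2.1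
    · exact (hJ y hy a b).2.2
    · rcases h with h | h
      · exact sub_mem (tmul_mem_tensorSpan (Or.inl (hJ c h a b).2.2))
          (tmul_mem_tensorSpan (Or.inr h))
      · exact sub_mem (tmul_mem_tensorSpan (Or.inr h))
          (tmul_mem_tensorSpan (Or.inl (hJ d h a b).2.2))

/-- The first derived subspace of `𝕀(J)` lies in `D ⊕ (J ⊗ J + i(D))`,
where `D` is the first derived ideal of `J`. -/
theorem IsIdealT.bspan_IU_le (hJ : IsIdealT t J) :
    bspan t (IU J) (IU J) ≤ (derStep t J).prod
      (tensorSpan K fun a b => (a ∈ J ∧ b ∈ J) ∨ a ∈ derStep t J ∨ b ∈ derStep t J) := by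
  rw [IU, iI_eq_tensorSpan]
  refine bspan_le fun x hx y hy => bkt_mem_prod (fun a ha b hb => ?_) (fun a ha c d h => ?_)
    (fun a b h y hy => ?_) (fun a b h c d h' => ?_) hx hy
  · exact tmul_mem_tensorSpan (Or.inl ⟨ha, hb⟩)
  · rcases h with h | h
    · exact sub_mem (derStep_mem_right d ha h) (derStep_mem_mid d ha h)
    · exact sub_mem (derStep_mem_mid c ha h) (derStep_mem_right c ha h)
  · exact h.elim (fun h => derStep_mem_mid b h hy) (fun h => derStep_mem_left a h hy)
  · have h₁ : ∀ y, t a b y ∈ J := fun y =>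
      h.elim (fun h => (hJ a h b y).1) (fun h => (hJ b h a y).2.1)
    have h₂ : ∀ y ∈ J, t a b y ∈ derStep t J := fun y hy =>
      h.elim (fun h => derStep_mem_mid b h hy) (fun h => derStep_mem_left a h hy)
    rcases h' with h' | h'
    · exact sub_mem (tmul_mem_tensorSpan (Or.inr (Or.inl (h₂ c h'))))
        (tmul_mem_tensorSpan (Or.inl ⟨h₁ d, h'⟩))
    · exact sub_mem (tmul_mem_tensorSpan (Or.inl ⟨h₁ c, h'⟩))
        (tmul_mem_tensorSpan (Or.inr (Or.inl (h₂ d h'))))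

theorem IsIdealT.derStep (h1 : LTS1 t) (h2 : LTS2 t) (hJ : IsIdealT t J) :
    IsIdealT t (derStep t J) := by
  intro x hx a b
  have hx' := inl_derStep_le_bspan h1 h2 hJ.isIdealU_IU (fun y hy => ⟨hy, zero_mem _⟩) x hx
  have hW := hJ.isIdealU_IU.bspan_self_sup h1 h2
  have key : ∀ {a b c : T}, bkt t (bkt t (a, 0) (b, 0)) (c, 0) ∈ bspan t (IU J) (IU J) ⊔ JU t ⊥ →
      t a b c ∈ _root_.derStep t J := by
    intro a b c h
    rw [bkt_bkt_inl] at h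
    have hle : bspan t (IU J) (IU J) ⊔ JU t ⊥ ≤ (_root_.derStep t J).prod ⊤ :=
      sup_le (hJ.bspan_IU_le.trans (Submodule.prod_mono le_rfl le_top))
        (Submodule.prod_mono bot_le le_top)
    exact (hle h).1
  exact ⟨key (hW _ (hW _ hx' _).1 _).1, key (hW _ (hW _ hx' _).2 _).1, key (hW _ hx' _).2⟩

theorem IsIdealT.bspan_bspan_IU_le (h1 : LTS1 t) (h2 : LTS2 t) (hJ : IsIdealT t J) :
    bspan t (bspan t (IU J) (IU J)) (bspan t (IU J) (IU J)) ≤ IU (_root_.derStep t J) := by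
  refine (bspan_mono hJ.bspan_IU_le hJ.bspan_IU_le).trans ?_
  have hJ' := hJ.derStep h1 h2
  rw [IU, iI_eq_tensorSpan]
  refine bspan_le fun x hx y hy => bkt_mem_prod (fun a ha b hb => ?_) (fun a ha c d _ => ?_)
    (fun a b _ y hy => (hJ' y hy a b).2.2) (fun a b h c d h' => ?_) hx hy
  · exact tmul_mem_tensorSpan (Or.inl ha)
  · exact sub_mem (hJ' a ha c d).1 (hJ' a ha d c).1
  · have h₁ : ∀ y, t a b y ∈ _root_.derStep t J := fun y => by
      rcases h with h | h | h
      · exact derStep_mem_right y h.1 h.2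
      · exact (hJ' a h b y).1
      · exact (hJ' b h a y).2.1
    exact sub_mem (tmul_mem_tensorSpan (Or.inl (h₁ c))) (tmul_mem_tensorSpan (Or.inl (h₁ d)))

theorem IsIdealT.derT (h1 : LTS1 t) (h2 : LTS2 t) (hJ : IsIdealT t J) (n : ℕ) :
    IsIdealT t (derT t J n) := by
  induction n with
  | zero => exact hJ
  | succ n ih => exact ih.derStep h1 h2

theorem derU_IU_le (h1 : LTS1 t) (h2 : LTS2 t) (hJ : IsIdealT t J) (n : ℕ) :
    derU t (IU J) (2 * n) ≤ IU (derT t J n) := by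
  induction n with
  | zero => exact le_rfl
  | succ n ih =>
    exact (bspan_mono (bspan_mono ih ih) (bspan_mono ih ih)).trans
      ((hJ.derT h1 h2 n).bspan_bspan_IU_le h1 h2)

theorem exists_isIdealU_le_derU_sup (h1 : LTS1 t) (h2 : LTS2 t) (hJ : IsIdealT t J) (n : ℕ) :
    ∃ W, IsIdealU t W ∧ (∀ x ∈ derT t J n, (x, 0) ∈ W) ∧ W ≤ derU t (IU J) n ⊔ JU t ⊥ := by
  induction n with
  | zero => exact ⟨IU J, hJ.isIdealU_IU, fun x hx => ⟨hx, zero_mem _⟩, le_sup_left⟩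
  | succ n ih =>
    obtain ⟨W, hW, hJW, hle⟩ := ih
    refine ⟨_, hW.bspan_self_sup h1 h2, inl_derStep_le_bspan h1 h2 hW hJW,
      sup_le (bspan_le fun x hx y hy => ?_) le_sup_right⟩
    obtain ⟨v, hv, s, hs, rfl⟩ := Submodule.mem_sup.1 (hle hx)
    obtain ⟨v', hv', s', hs', rfl⟩ := Submodule.mem_sup.1 (hle hy)
    rw [bkt_add_left, bkt_add_right]
    exact add_mem (add_mem (Submodule.mem_sup_left (bkt_mem_bspan hv hv'))
      (Submodule.mem_sup_right (bkt_mem_JU_bot_right h1 h2 hs' v)))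
      (Submodule.mem_sup_right (bkt_mem_JU_bot_left hs _))

theorem isSolvT_iff_isSolvU_IU (h1 : LTS1 t) (h2 : LTS2 t) (hJ : IsIdealT t J) :
    IsSolvT t J ↔ IsSolvU t (IU J) := by
  constructor
  · rintro ⟨k, hk⟩
    refine ⟨2 * k, le_bot_iff.1 ((derU_IU_le h1 h2 hJ k).trans ?_)⟩
    rw [hk, IU_bot]
  · rintro ⟨k, hk⟩
    refine ⟨k, (Submodule.eq_bot_iff _).2 fun x hx => ?_⟩
    obtain ⟨W, -, hJW, hle⟩ := exists_isIdealU_le_derU_sup h1 h2 hJ k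
    rw [hk, bot_sup_eq] at hle
    exact (mem_JU_bot.1 (hle (hJW x hx))).1

theorem IsIdealT.IU_le_JU (hJ : IsIdealT t J) : IU J ≤ JU t J := by
  refine Submodule.prod_mono le_rfl (Submodule.span_le.2 ?_)
  rintro _ (⟨x, hx, a, rfl⟩ | ⟨x, hx, a, rfl⟩) <;> refine mem_jI.2 fun b => ?_
  · simpa using ⟨(hJ x hx a b).1, sub_mem (hJ x hx b a).2.1 (hJ x hx b a).2.2⟩
  · simpa using ⟨(hJ x hx a b).2.1, sub_mem (hJ x hx b a).2.2 (hJ x hx b a).2.1⟩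

theorem rTensor_mem_iI {f : T →ₗ[K] T} (hf : ∀ a, f a ∈ J) (w : T ⊗[K] T) :
    LinearMap.rTensor T f w ∈ iI J := by
  induction w with
  | zero => simp
  | tmul a b => exact Submodule.subset_span (Or.inl ⟨f a, hf a, b, by simp⟩)
  | add u v hu hv => simpa using add_mem hu hv

theorem bspan_JU_le : bspan t (JU t J) (JU t J) ≤ IU J := by
  refine bspan_le ?_
  rintro ⟨x, w⟩ ⟨hx, hw⟩ ⟨y, v⟩ ⟨-, hv⟩
  have hw' : ∀ a, TensorProduct.lift t w a ∈ J := fun a => (mem_jI.1 hw a).1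
  refine ⟨?_, sub_mem (add_mem ?_ (rTensor_mem_iI hw' _)) (rTensor_mem_iI hw' _)⟩
  · change _ + _ - _ ∈ J
    rw [add_sub_assoc]
    exact add_mem (hw' y) (mem_jI.1 hv x).2
  · exact Submodule.subset_span (Or.inl ⟨x, hx, y, rfl⟩)

theorem isSolvU_IU_iff_isSolvU_JU (hJ : IsIdealT t J) :
    IsSolvU t (IU J) ↔ IsSolvU t (JU t J) :=
  ⟨fun h => (h.mono bspan_JU_le).of_bspan, fun h => h.mono hJ.IU_le_JU⟩

end Ideal

/-- For an ideal `I` of `T`: `I` is solvable iff `𝕀(I)` is a solvable ideal of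
`U(T)` iff `𝕁(I)` is a solvable ideal of `U(T)`. In particular `T` is solvable
iff `U(T)` is a solvable Leibniz algebra. -/
theorem solvability_equivalences
    (t : T →ₗ[K] T →ₗ[K] T →ₗ[K] T) (h1 : LTS1 t) (h2 : LTS2 t)
    (I : Submodule K T) (hI : IsIdealT t I) :
    (IsSolvT t I ↔ IsSolvU t (IU I)) ∧
    (IsSolvT t I ↔ IsSolvU t (JU t I)) ∧
    (IsSolvT t (⊤ : Submodule K T) ↔
      IsSolvU t (⊤ : Submodule K (T × (T ⊗[K] T)))) := by
  have h := isSolvT_iff_isSolvU_IU h1 h2 hI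
  refine ⟨h, h.trans (isSolvU_IU_iff_isSolvU_JU hI), ?_⟩
  rw [← IU_top]
  exact isSolvT_iff_isSolvU_IU h1 h2 fun _ _ _ _ => ⟨trivial, trivial, trivial⟩

end
end
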